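/- The coproduct Δ is multiplicative with respect to the shifted concatenation product: for all packed words u and v, Δ(u*v) = Δ(u) · Δ(v), where the product on H ⊗ H is the componentwise shifted concatenation ( (a⊗b)·(c⊗d) = (a*c) ⊗ (b*d) ). Hence Δ is an algebra morphism from H to H ⊗ H. -/

import Mathlib

/-- Words over the alphabet `X = {x_i : i ≥ 0}`, identified with lists of natural numbers. -/
abbrev Word : Type := List ℕ

/-- `IAlph w` is the set of indices of letters occurring in `w`. -/
def IAlph (w : Word) : Finset ℕ := w.toFinset

/-- `wsup w` is the supremum of `IAlph w` (0 for the empty word). -/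
def wsup (w : Word) : ℕ := w.foldr max 0

/-- The substitution `S_φ` replaces each letter `x_i` by `x_{φ i}`. -/
def subst (φ : ℕ → ℕ) (w : Word) : Word := w.map φ

/-- The packing substitution `φ_w`: it sends the `m`-th smallest nonzero letter of `w` to `m`,
and `0` to `0`. -/
def packMap (w : Word) (i : ℕ) : ℕ := (((IAlph w).erase 0).filter (fun j => j ≤ i)).card

/-- `pack w = S_{φ_w} w`. -/
def pack (w : Word) : Word := subst (packMap w) w

/-- A word is packed if `pack w = w`. -/
def IsPacked (w : Word) : Prop := pack w = w

/-- `T_t`: shift every nonzero letter by `t`, fixing `x_0`. -/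
def shiftW (t : ℕ) (w : Word) : Word := subst (fun n => if n = 0 then 0 else n + t) w

/-- Shifted concatenation `u * v = u · T_{sup u}(v)`. -/
def sc (u v : Word) : Word := u ++ shiftW (wsup u) v

/-- `w[I]`: the subword of `w` formed by the letters at the (1-indexed) positions in `I`,
taken in increasing order of position. -/
def subword (w : Word) (I : Finset ℕ) : Word :=
  ((List.range w.length).filter (fun j => decide (j + 1 ∈ I))).map (fun j => w.getD j 0)

/-- Quotient by a set of indices: `w / A = S_{φ_A} w` where `φ_A i = 0` if `i ∈ A`, else `i`. -/
def quotSet (w : Word) (A : Finset ℕ) : Word := subst (fun i => if i ∈ A then 0 else i) w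

/-- Quotient by a word: `w / u = w / IAlph u`. -/
def quotWord (w u : Word) : Word := quotSet w (IAlph u)

/-- The product on the span of words: the bilinear extension of the shifted concatenation. -/
noncomputable def Hmul (k : Type) [Field k] (f g : Word →₀ k) : Word →₀ k :=
  f.sum fun u a => g.sum fun v b => Finsupp.single (sc u v) (a * b)

/-- The coproduct on basis words, with values in `H ⊗ H` identified with the free vector
space on pairs of words:
`Δ(w) = Σ_{I ⊔ J = {1,…,|w|}} pack(w[I]) ⊗ pack(w[J]/w[I])`. -/
noncomputable def coprod (k : Type) [Field k] (w : Word) : (Word × Word) →₀ k :=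
  ∑ I ∈ (Finset.Icc 1 w.length).powerset,
    Finsupp.single
      (pack (subword w I),
        pack (quotWord (subword w (Finset.Icc 1 w.length \ I)) (subword w I)))
      (1 : k)

/-- The product on `H ⊗ H` (identified with the free vector space on pairs of words):
componentwise shifted concatenation, `(a ⊗ b)·(c ⊗ d) = (a*c) ⊗ (b*d)`. -/
noncomputable def HHmul (k : Type) [Field k] (F G : (Word × Word) →₀ k) :
    (Word × Word) →₀ k :=
  F.sum fun p c => G.sum fun q d => Finsupp.single (sc p.1 q.1, sc p.2 q.2) (c * d)

/-- The linear extension of `Δ` to the span of packed words. -/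
noncomputable def coprodL (k : Type) [Field k] (f : Word →₀ k) : (Word × Word) →₀ k :=
  f.sum fun w c => c • coprod k w

theorem le_wsup {w : Word} {i : ℕ} (h : i ∈ w) : i ≤ wsup w := by
  induction w with
  | nil => simp at h
  | cons a w ih =>
    rw [wsup, List.foldr_cons]
    rcases List.mem_cons.1 h with rfl | h
    · exact le_max_left _ _
    · exact (ih h).trans (le_max_right _ _)

theorem wsup_le {w : Word} {n : ℕ} (h : ∀ i ∈ w, i ≤ n) : wsup w ≤ n := by
  induction w with
  | nil => exact Nat.zero_le n
  | cons a w ih =>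
    rw [wsup, List.foldr_cons]
    exact max_le (h a (by simp)) (ih fun i hi => h i (by simp [hi]))

theorem mem_IAlph {w : Word} {i : ℕ} : i ∈ IAlph w ↔ i ∈ w := List.mem_toFinset

/-- The largest letter of a packed word counts the distinct nonzero letters. -/
theorem wsup_pack (w : Word) : wsup (pack w) = ((IAlph w).erase 0).card := by
  apply le_antisymm
  · apply wsup_le
    intro i hi
    obtain ⟨j, -, rfl⟩ := List.mem_map.1 hi
    exact Finset.card_filter_le _ _
  · rcases ((IAlph w).erase 0).eq_empty_or_nonempty with h | h
    · simp [h]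
    · have hm := Finset.max'_mem _ h
      have hw := mem_IAlph.1 (Finset.mem_of_mem_erase hm)
      refine le_trans (le_of_eq ?_) (le_wsup (List.mem_map_of_mem (f := packMap w) hw))
      rw [packMap, Finset.filter_true_of_mem fun j hj => Finset.le_max' _ j hj]

theorem mem_shiftW {t i : ℕ} {w : Word} :
    i ∈ shiftW t w ↔ ∃ j ∈ w, (if j = 0 then 0 else j + t) = i := List.mem_map

theorem packMap_zero (w : Word) : packMap w 0 = 0 := by
  simp only [packMap, Finset.card_eq_zero, Finset.filter_eq_empty_iff, Finset.mem_erase]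
  omega

theorem packMap_eq_zero_iff {w : Word} {i : ℕ} (h : i ∈ w) : packMap w i = 0 ↔ i = 0 := by
  refine ⟨fun h0 => ?_, fun h0 => h0 ▸ packMap_zero w⟩
  by_contra hi
  rw [packMap, Finset.card_eq_zero, Finset.filter_eq_empty_iff] at h0
  exact h0 (Finset.mem_erase.2 ⟨hi, mem_IAlph.2 h⟩) le_rfl

theorem packMap_append_shiftW_of_le {x : Word} (y : Word) {s i : ℕ} (hi : i ≤ s) :
    packMap (x ++ shiftW s y) i = packMap x i := by
  unfold packMap
  congr 1
  ext j
  simp only [Finset.mem_filter, Finset.mem_erase, mem_IAlph, List.mem_append, mem_shiftW]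
  constructor
  · rintro ⟨⟨h0, h | ⟨l, -, hl⟩⟩, hj⟩
    · exact ⟨⟨h0, h⟩, hj⟩
    · split_ifs at hl <;> omega
  · rintro ⟨⟨h0, h⟩, hj⟩
    exact ⟨⟨h0, Or.inl h⟩, hj⟩

theorem packMap_append_shiftW_add {x : Word} (y : Word) {s : ℕ} (hx : ∀ i ∈ x, i ≤ s) (i : ℕ) :
    packMap (x ++ shiftW s y) (i + s) = packMap y i + ((IAlph x).erase 0).card := by
  have key : ((IAlph (x ++ shiftW s y)).erase 0).filter (fun j => j ≤ i + s) =
      ((((IAlph y).erase 0).filter (fun j => j ≤ i)).map (addRightEmbedding s)) ∪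
        (IAlph x).erase 0 := by
    ext j
    simp only [Finset.mem_filter, Finset.mem_erase, mem_IAlph, List.mem_append, mem_shiftW,
      Finset.mem_union, Finset.mem_map, addRightEmbedding_apply]
    constructor
    · rintro ⟨⟨h0, h | ⟨l, hl, hlj⟩⟩, hj⟩
      · exact Or.inr ⟨h0, h⟩
      · split_ifs at hlj with hl0
        · omega
        · exact Or.inl ⟨l, ⟨⟨hl0, hl⟩, by omega⟩, hlj⟩
    · rintro (⟨l, ⟨⟨hl0, hl⟩, hli⟩, rfl⟩ | ⟨h0, h⟩)
      · exact ⟨⟨by omega, Or.inr ⟨l, hl, if_neg hl0⟩⟩, by omega⟩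
      · have := hx j h
        exact ⟨⟨h0, Or.inl h⟩, by omega⟩
  rw [packMap, key, Finset.card_union_of_disjoint, Finset.card_map]
  · rfl
  · rw [Finset.disjoint_left]
    intro j hj hjx
    obtain ⟨l, hl, rfl⟩ := Finset.mem_map.1 hj
    have h1 := hx _ (mem_IAlph.1 (Finset.mem_of_mem_erase hjx))
    have h2 := Finset.ne_of_mem_erase (Finset.mem_filter.1 hl).1
    rw [addRightEmbedding_apply] at h1
    omega

theorem pack_append_shiftW {x : Word} (y : Word) {s : ℕ} (hx : ∀ i ∈ x, i ≤ s) :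
    pack (x ++ shiftW s y) = sc (pack x) (pack y) := by
  rw [sc, wsup_pack, pack, subst, List.map_append]
  congr 1
  · exact List.map_congr_left fun i hi => packMap_append_shiftW_of_le y (hx i hi)
  · simp only [shiftW, pack, subst, List.map_map]
    refine List.map_congr_left fun i hi => ?_
    simp only [Function.comp_apply, packMap_eq_zero_iff hi]
    split_ifs
    · exact packMap_zero _
    · exact packMap_append_shiftW_add y hx i

theorem quotWord_append_shiftW {x x' : Word} (y y' : Word) {s : ℕ} (hx : ∀ i ∈ x, i ≤ s)
    (hx' : ∀ i ∈ x', i ≤ s) :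
    quotWord (x ++ shiftW s y) (x' ++ shiftW s y') =
      quotWord x x' ++ shiftW s (quotWord y y') := by
  simp only [quotWord, quotSet, subst, List.map_append]
  congr 1
  · refine List.map_congr_left fun i hi => ?_
    have h := hx i hi
    simp only [mem_IAlph, List.mem_append, mem_shiftW]
    by_cases hi' : i ∈ x'
    · simp [hi']
    · by_cases h0 : i = 0
      · simp [h0]
      · rw [if_neg, if_neg hi']
        rintro (h1 | ⟨l, -, hl⟩)
        · exact hi' h1
        · split_ifs at hl <;> omega
  · simp only [shiftW, subst, List.map_map]
    refine List.map_congr_left fun i _ => ?_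
    simp only [Function.comp_apply, mem_IAlph, List.mem_append]
    by_cases h0 : i = 0
    · simp [h0]
    · have hiff : (i + s ∈ x' ∨ i + s ∈ List.map (fun n => if n = 0 then 0 else n + s) y') ↔
          i ∈ y' := by
        rw [List.mem_map]
        constructor
        · rintro (h1 | ⟨l, hl, hli⟩)
          · have := hx' _ h1
            omega
          · split_ifs at hli
            · omega
            · obtain rfl : l = i := by omega
              exact hl
        · exact fun h => Or.inr ⟨i, h, if_neg h0⟩
      simp only [if_neg h0, hiff]
      by_cases hy : i ∈ y' <;> simp [hy, h0]

theorem subword_append (u v : Word) {I J K : Finset ℕ}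
    (hI : ∀ j < u.length, j + 1 ∈ K ↔ j + 1 ∈ I)
    (hJ : ∀ j < v.length, u.length + j + 1 ∈ K ↔ j + 1 ∈ J) :
    subword (u ++ v) K = subword u I ++ subword v J := by
  rw [subword, List.length_append, List.range_add, List.filter_append, List.map_append]
  congr 1
  · rw [subword, List.filter_congr (q := fun j => decide (j + 1 ∈ I))
      fun j hj => decide_eq_decide.2 (hI j (List.mem_range.1 hj))]
    refine List.map_congr_left fun j hj => ?_
    exact List.getD_append _ _ _ _ (List.mem_range.1 (List.mem_filter.1 hj).1)
  · rw [subword, List.filter_map, List.map_map, List.filter_congr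
      (p := (fun j => decide (j + 1 ∈ K)) ∘ (u.length + ·)) (q := fun j => decide (j + 1 ∈ J))
      fun j hj => decide_eq_decide.2 (hJ j (List.mem_range.1 hj))]
    refine List.map_congr_left fun j _ => ?_
    rw [Function.comp_apply, List.getD_append_right _ _ _ _ (Nat.le_add_right _ _),
      Nat.add_sub_cancel_left]

theorem subword_shiftW (t : ℕ) (w : Word) (I : Finset ℕ) :
    subword (shiftW t w) I = shiftW t (subword w I) := by
  simp only [subword, shiftW, subst, List.length_map, List.map_map]
  refine List.map_congr_left fun j hj => ?_
  have hj' := List.mem_range.1 (List.mem_filter.1 hj).1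
  simp [List.getD_eq_getElem?_getD, List.getElem?_eq_getElem hj']

theorem mem_of_mem_subword {w : Word} {I : Finset ℕ} {i : ℕ} (h : i ∈ subword w I) : i ∈ w := by
  obtain ⟨j, hj, rfl⟩ := List.mem_map.1 h
  have hj' := List.mem_range.1 (List.mem_filter.1 hj).1
  rw [List.getD_eq_getElem _ _ hj']
  exact List.getElem_mem hj'

theorem length_shiftW (t : ℕ) (w : Word) : (shiftW t w).length = w.length := List.length_map _

/-- Glue sets of positions of two words into a set of positions of their concatenation. -/
def glue (n : ℕ) (I J : Finset ℕ) : Finset ℕ := I ∪ J.map (addLeftEmbedding n)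

theorem mem_glue {n : ℕ} {I J : Finset ℕ} {i : ℕ} :
    i ∈ glue n I J ↔ i ∈ I ∨ ∃ j ∈ J, n + j = i := by
  simp [glue]

theorem subword_sc (u v : Word) {I J K : Finset ℕ}
    (hI : ∀ j < u.length, j + 1 ∈ K ↔ j + 1 ∈ I)
    (hJ : ∀ j < v.length, u.length + j + 1 ∈ K ↔ j + 1 ∈ J) :
    subword (sc u v) K = subword u I ++ shiftW (wsup u) (subword v J) := by
  rw [sc, subword_append u _ hI (J := J) (by rwa [length_shiftW]), subword_shiftW]

/-- The summand of `coprod w` indexed by the set of positions `I`. -/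
def coprodTerm (w : Word) (I : Finset ℕ) : Word × Word :=
  (pack (subword w I),
    pack (quotWord (subword w (Finset.Icc 1 w.length \ I)) (subword w I)))

theorem coprodTerm_sc (u v : Word) {I J : Finset ℕ} (hI : I ⊆ Finset.Icc 1 u.length)
    (hJ : J ⊆ Finset.Icc 1 v.length) :
    coprodTerm (sc u v) (glue u.length I J) =
      (sc (coprodTerm u I).1 (coprodTerm v J).1, sc (coprodTerm u I).2 (coprodTerm v J).2) := by
  have hlt : ∀ j < u.length, j + 1 ∈ glue u.length I J ↔ j + 1 ∈ I := by
    intro j hj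
    rw [mem_glue, or_iff_left]
    rintro ⟨l, hl, h⟩
    have := Finset.mem_Icc.1 (hJ hl)
    omega
  have hge : ∀ j < v.length, u.length + j + 1 ∈ glue u.length I J ↔ j + 1 ∈ J := by
    intro j _
    rw [mem_glue, or_iff_right]
    · exact ⟨fun ⟨l, hl, h⟩ => by rwa [show j + 1 = l by omega], fun h => ⟨_, h, by omega⟩⟩
    · intro h
      have := Finset.mem_Icc.1 (hI h)
      omega
  have hlen : (sc u v).length = u.length + v.length := by
    rw [sc, List.length_append, length_shiftW]
  have hsub := subword_sc u v hlt hge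
  have hcompl := subword_sc u v (K := Finset.Icc 1 (sc u v).length \ glue u.length I J)
    (I := Finset.Icc 1 u.length \ I) (J := Finset.Icc 1 v.length \ J)
    (fun j hj => by
      rw [Finset.mem_sdiff, Finset.mem_sdiff, hlt j hj, Finset.mem_Icc, Finset.mem_Icc, hlen]
      exact and_congr_left' (by omega))
    (fun j hj => by
      rw [Finset.mem_sdiff, Finset.mem_sdiff, hge j hj, Finset.mem_Icc, Finset.mem_Icc, hlen]
      exact and_congr_left' (by omega))
  have hle : ∀ K, ∀ i ∈ subword u K, i ≤ wsup u := fun K i hi => le_wsup (mem_of_mem_subword hi)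
  have hle' : ∀ K K', ∀ i ∈ quotWord (subword u K) (subword u K'), i ≤ wsup u := by
    intro K K' i hi
    obtain ⟨j, hj, rfl⟩ := List.mem_map.1 hi
    have := hle K j hj
    split_ifs <;> omega
  simp only [coprodTerm]
  rw [hsub, hcompl, quotWord_append_shiftW _ _ (hle _) (hle _), pack_append_shiftW _ (hle _),
    pack_append_shiftW _ (hle' _ _)]

theorem sum_powerset_glue {M : Type*} [AddCommMonoid M] (m n : ℕ) (f : Finset ℕ → M) :
    ∑ K ∈ (Finset.Icc 1 (m + n)).powerset, f K =
      ∑ I ∈ (Finset.Icc 1 m).powerset, ∑ J ∈ (Finset.Icc 1 n).powerset, f (glue m I J) := by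
  rw [← Finset.sum_product']
  symm
  refine Finset.sum_nbij' (fun p => glue m p.1 p.2)
    (fun K => ((Finset.Icc 1 m).filter (· ∈ K), (Finset.Icc 1 n).filter (m + · ∈ K)))
    ?_ ?_ ?_ ?_ (fun _ _ => rfl)
  · rintro ⟨I, J⟩ h
    simp only [Finset.mem_product, Finset.mem_powerset] at h ⊢
    intro i hi
    rw [Finset.mem_Icc]
    rcases mem_glue.1 hi with hi | ⟨j, hj, rfl⟩
    · have := Finset.mem_Icc.1 (h.1 hi)
      omega
    · have := Finset.mem_Icc.1 (h.2 hj)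
      omega
  · intro K _
    simp only [Finset.mem_product, Finset.mem_powerset]
    exact ⟨Finset.filter_subset _ _, Finset.filter_subset _ _⟩
  · rintro ⟨I, J⟩ h
    simp only [Finset.mem_product, Finset.mem_powerset] at h
    ext i
    · simp only [Finset.mem_filter, mem_glue, Finset.mem_Icc]
      constructor
      · rintro ⟨hi, h1 | ⟨j, hj, hji⟩⟩
        · exact h1
        · have := Finset.mem_Icc.1 (h.2 hj)
          omega
      · exact fun hi => ⟨Finset.mem_Icc.1 (h.1 hi), Or.inl hi⟩
    · simp only [Finset.mem_filter, mem_glue, Finset.mem_Icc]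
      constructor
      · rintro ⟨hi, h1 | ⟨j, hj, hji⟩⟩
        · have := Finset.mem_Icc.1 (h.1 h1)
          omega
        · obtain rfl : j = i := by omega
          exact hj
      · exact fun hi => ⟨Finset.mem_Icc.1 (h.2 hi), Or.inr ⟨i, hi, rfl⟩⟩
  · intro K hK
    rw [Finset.mem_powerset] at hK
    ext i
    simp only [mem_glue, Finset.mem_filter, Finset.mem_Icc]
    constructor
    · rintro (⟨-, h⟩ | ⟨j, ⟨-, h⟩, rfl⟩) <;> exact h
    · intro h
      have := Finset.mem_Icc.1 (hK h)
      by_cases him : i ≤ m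
      · exact Or.inl ⟨by omega, h⟩
      · exact Or.inr ⟨i - m, ⟨by omega, by rwa [show m + (i - m) = i by omega]⟩, by omega⟩

section Bilinear

variable (k : Type) [Field k]

/-- The bilinear extension of a binary operation to the free vector space. -/
noncomputable def bilinearExt {α : Type*} (op : α → α → α) :
    (α →₀ k) →ₗ[k] (α →₀ k) →ₗ[k] (α →₀ k) :=
  Finsupp.lsum k fun a => LinearMap.flip <| Finsupp.lsum k fun b =>
    LinearMap.flip ((LinearMap.mul k k).compr₂ (Finsupp.lsingle (op a b)))

theorem bilinearExt_apply {α : Type*} (op : α → α → α) (f g : α →₀ k) :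
    bilinearExt k op f g =
      f.sum fun a c => g.sum fun b d => Finsupp.single (op a b) (c * d) := by
  simp [bilinearExt, Finsupp.lsum_apply, Finsupp.sum, LinearMap.sum_apply]

theorem bilinearExt_single {α : Type*} (op : α → α → α) (a b : α) (c d : k) :
    bilinearExt k op (Finsupp.single a c) (Finsupp.single b d) =
      Finsupp.single (op a b) (c * d) := by
  simp [bilinearExt_apply]

theorem Hmul_eq_bilinearExt (f g : Word →₀ k) : Hmul k f g = bilinearExt k sc f g :=
  (bilinearExt_apply k sc f g).symm

theorem HHmul_eq_bilinearExt (F G : (Word × Word) →₀ k) :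
    HHmul k F G = bilinearExt k (fun p q => (sc p.1 q.1, sc p.2 q.2)) F G :=
  (bilinearExt_apply k _ F G).symm

theorem coprod_sc (u v : Word) :
    coprod k (sc u v) = HHmul k (coprod k u) (coprod k v) := by
  have hcoprod : ∀ w, coprod k w = ∑ I ∈ (Finset.Icc 1 w.length).powerset,
      Finsupp.single (coprodTerm w I) (1 : k) := fun _ => rfl
  rw [HHmul_eq_bilinearExt, hcoprod, hcoprod u, hcoprod v, sc, List.length_append, length_shiftW,
    sum_powerset_glue, LinearMap.map_sum₂]
  refine Finset.sum_congr rfl fun I hI => ?_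
  rw [map_sum]
  refine Finset.sum_congr rfl fun J hJ => ?_
  rw [bilinearExt_single, mul_one, ← sc,
    coprodTerm_sc u v (Finset.mem_powerset.1 hI) (Finset.mem_powerset.1 hJ)]

theorem coprodL_eq_linearCombination (f : Word →₀ k) :
    coprodL k f = Finsupp.linearCombination k (coprod k) f := rfl

theorem coprodL_Hmul (f g : Word →₀ k) :
    coprodL k (Hmul k f g) = HHmul k (coprodL k f) (coprodL k g) := by
  simp only [Hmul_eq_bilinearExt, HHmul_eq_bilinearExt, coprodL_eq_linearCombination]
  induction f using Finsupp.induction_linear with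
  | zero => simp
  | add f f' hf hf' => simp only [map_add, LinearMap.add_apply, hf, hf']
  | single u a =>
    induction g using Finsupp.induction_linear with
    | zero => simp
    | add g g' hg hg' => simp only [map_add, hg, hg']
    | single v b =>
      rw [bilinearExt_single, Finsupp.linearCombination_single, Finsupp.linearCombination_single,
        Finsupp.linearCombination_single, coprod_sc, HHmul_eq_bilinearExt, map_smul, map_smul,
        LinearMap.smul_apply, smul_smul, mul_comm]

end Bilinear

/-- `Δ` is multiplicative for the shifted concatenation:
`Δ(u * v) = Δ(u)·Δ(v)` for packed words `u, v`, where `H ⊗ H` carries the componentwise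
product; moreover `Δ(1) = 1 ⊗ 1`, so `Δ` is a morphism of algebras `H → H ⊗ H`. -/
theorem coprod_mul (k : Type) [Field k] :
    (∀ u v : Word, IsPacked u → IsPacked v →
      coprod k (sc u v) = HHmul k (coprod k u) (coprod k v)) ∧
    coprod k ([] : Word) = Finsupp.single (([] : Word), ([] : Word)) (1 : k) ∧
    (∀ f g : Word →₀ k,
      (∀ w ∈ f.support, IsPacked w) → (∀ w ∈ g.support, IsPacked w) →
      coprodL k (Hmul k f g) = HHmul k (coprodL k f) (coprodL k g)) := by
  refine ⟨fun u v _ _ => coprod_sc k u v, ?_, fun f g _ _ => coprodL_Hmul k f g⟩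
  simp [coprod, subword, quotWord, quotSet, pack, subst]
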